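/- (Asynchrony directional-error bound.) Let X ⊆ ℝ^n be nonempty, closed and convex, let ε > 0, let g : ℕ → ℝ^n, and let x : ℕ → ℝ^n satisfy x_1 ∈ X and x_{s+1} = P_X(x_s − ε g_s) for all s ≥ 1. Fix t ≥ 1 and an integer delay τ_t with 0 ≤ τ_t ≤ min(τ, t − 1) for some integer bound τ ≤ t − 1. Then the directional error caused by the asynchronous update satisfies ⟨g_t, x_{t−τ_t} − x_t⟩ ≤ (ε/2)·(τ‖g_t‖² + Σ_{s=t−τ}^{t−1} ‖g_s‖²). -/

import Mathlib

open RealInnerProductSpace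

/-- A nearest point of a convex set to `y` is at most as far from a point `u` of the set
as `y` is. -/
theorem norm_sub_le_of_isNearest {E : Type*} [NormedAddCommGroup E] [InnerProductSpace ℝ E]
    {X : Set E} (hX : Convex ℝ X) {y p u : E} (hp : p ∈ X)
    (hmin : ∀ z ∈ X, dist y p ≤ dist y z) (hu : u ∈ X) : ‖u - p‖ ≤ ‖u - y‖ := by
  have hinf : ‖y - p‖ = ⨅ w : X, ‖y - w‖ := by
    have : Nonempty X := ⟨⟨p, hp⟩⟩
    refine le_antisymm (le_ciInf fun w => ?_) (ciInf_le ⟨0, ?_⟩ (⟨p, hp⟩ : X))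
    · simpa [dist_eq_norm] using hmin w w.2
    · rintro _ ⟨w, rfl⟩
      exact norm_nonneg _
  have hobtuse := (norm_eq_iInf_iff_real_inner_le_zero hX hp).1 hinf u hu
  have hsplit : ‖u - p‖ ^ 2 = ⟪u - y, u - p⟫ + ⟪y - p, u - p⟫ := by
    rw [← inner_add_left, sub_add_sub_cancel, real_inner_self_eq_norm_sq]
  have hcs := real_inner_le_norm (u - y) (u - p)
  by_contra! h
  nlinarith [norm_nonneg (u - y)]

/-- A sequence with steps bounded by `ε ‖g s‖` has directional drift controlled by the squared
norms of `g` along the way. -/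
theorem inner_sub_le_of_norm_step_le {E : Type*} [NormedAddCommGroup E] [InnerProductSpace ℝ E]
    {ε : ℝ} (hε : 0 ≤ ε) {g x : ℕ → E} (c : E) {a b : ℕ} (hab : a ≤ b)
    (hstep : ∀ s, a ≤ s → ‖x s - x (s + 1)‖ ≤ ε * ‖g s‖) :
    ⟪c, x a - x b⟫ ≤ (ε / 2) * (((b - a : ℕ) : ℝ) * ‖c‖ ^ 2 + ∑ s ∈ Finset.Ico a b, ‖g s‖ ^ 2) := by
  induction b, hab using Nat.le_induction with
  | base => simp
  | succ b hab ih =>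
    rw [Finset.sum_Ico_succ_top hab, Nat.succ_sub hab, Nat.cast_succ,
      ← sub_add_sub_cancel (x a) (x b), inner_add_right]
    have hinner := (real_inner_le_norm c (x b - x (b + 1))).trans
      (mul_le_mul_of_nonneg_left (hstep b hab) (norm_nonneg c))
    nlinarith [mul_nonneg hε (sq_nonneg (‖c‖ - ‖g b‖))]

/-- **Asynchrony directional-error bound.**  For projected gradient iterates
`x_{s+1} = P_X(x_s - ε g_s)` (`s ≥ 1`) with `x_1 ∈ X`, a delay `τ_t` with
`0 ≤ τ_t ≤ min(τ, t-1)` and `τ ≤ t-1`, the directional error of the asynchronous update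
satisfies `⟨g_t, x_{t-τ_t} - x_t⟩ ≤ (ε/2)(τ‖g_t‖² + Σ_{s=t-τ}^{t-1} ‖g_s‖²)`. -/
theorem async_directional_error_bound {n : ℕ} (X : Set (EuclideanSpace ℝ (Fin n)))
    (hX : X.Nonempty) (hXclosed : IsClosed X) (hXconv : Convex ℝ X)
    (P : EuclideanSpace ℝ (Fin n) → EuclideanSpace ℝ (Fin n))
    (hP : ∀ y, P y ∈ X ∧ ∀ z ∈ X, dist y (P y) ≤ dist y z)
    (ε : ℝ) (hε : 0 < ε)
    (g x : ℕ → EuclideanSpace ℝ (Fin n))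
    (hx1 : x 1 ∈ X)
    (hrec : ∀ s, 1 ≤ s → x (s + 1) = P (x s - ε • g s))
    (t τ τt : ℕ) (ht : 1 ≤ t) (hτtτ : τt ≤ τ) (hτtt : τt ≤ t - 1) (hτ : τ ≤ t - 1) :
    ⟪g t, x (t - τt) - x t⟫ ≤
      (ε / 2) * ((τ : ℝ) * ‖g t‖ ^ 2 + ∑ s ∈ Finset.Icc (t - τ) (t - 1), ‖g s‖ ^ 2) := by
  have hmem : ∀ s, 1 ≤ s → x s ∈ X := by
    intro s hs
    induction s, hs using Nat.le_induction with
    | base => exact hx1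
    | succ s hs _ => exact hrec s hs ▸ (hP _).1
  have hstep : ∀ s, t - τt ≤ s → ‖x s - x (s + 1)‖ ≤ ε * ‖g s‖ := by
    intro s hs
    have hs1 : 1 ≤ s := by omega
    rw [hrec s hs1]
    refine (norm_sub_le_of_isNearest hXconv (hP _).1 (hP _).2 (hmem s hs1)).trans_eq ?_
    rw [sub_sub_cancel, norm_smul, Real.norm_of_nonneg hε.le]
  refine (inner_sub_le_of_norm_step_le hε.le (g t) (Nat.sub_le t τt) hstep).trans ?_
  have hsub : Finset.Ico (t - τt) t ⊆ Finset.Icc (t - τ) (t - 1) := by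
    intro s hs
    simp only [Finset.mem_Ico, Finset.mem_Icc] at hs ⊢
    omega
  have hlen : t - (t - τt) ≤ τ := by omega
  gcongr
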